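/- Let p > 1 and let Ω ⊂ ℝ^N be a bounded open set. Suppose ψ : cl(Ω) → ℝ is continuous, is C¹ on Ω with ψ = 0 on ∂Ω, its flux V_ψ is continuously differentiable on Ω, and div V_ψ(x) = −1 for all x ∈ Ω (i.e. ψ is the p-torsion function of Ω). If x₀ ∈ Ω and r > 0 are such that the open ball B_r(x₀) is contained in Ω, then ψ(x₀) ≥ ((p−1)/p)·N^{−1/(p−1)}·r^{p/(p−1)}; in particular sup_Ω ψ ≥ ((p−1)/p)·N^{−1/(p−1)}·r^{p/(p−1)}. -/

import Mathlib

open Real Set Metric MeasureTheory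

/-- The "flux" of `u` at `x`: `‖∇u(x)‖^(p-2) ∇u(x)` (equal to `0` when `∇u(x) = 0`,
by the junk-value conventions of `Real.rpow`, since `p ≠ 2` gives `0 ^ (p-2) = 0` and
for `p = 2` the scalar multiplies the zero vector). -/
noncomputable def flux {N : ℕ} (p : ℝ) (u : EuclideanSpace ℝ (Fin N) → ℝ)
    (x : EuclideanSpace ℝ (Fin N)) : EuclideanSpace ℝ (Fin N) :=
  ‖gradient u x‖ ^ (p - 2) • gradient u x

/-- The divergence of a vector field `V` at `x`: `∑ i, ∂V_i/∂x_i (x)`. -/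
noncomputable def pdiv {N : ℕ} (V : EuclideanSpace ℝ (Fin N) → EuclideanSpace ℝ (Fin N))
    (x : EuclideanSpace ℝ (Fin N)) : ℝ :=
  ∑ i : Fin N, fderiv ℝ V x (EuclideanSpace.single i 1) i

theorem pdiv_smul {N : ℕ} {k : EuclideanSpace ℝ (Fin N) → ℝ}
    {W : EuclideanSpace ℝ (Fin N) → EuclideanSpace ℝ (Fin N)} {x : EuclideanSpace ℝ (Fin N)}
    (hk : DifferentiableAt ℝ k x) (hW : DifferentiableAt ℝ W x) :
    pdiv (fun y => k y • W y) x = fderiv ℝ k x (W x) + k x * pdiv W x := by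
  have h1 : fderiv ℝ k x (W x) = ∑ i, W x i * fderiv ℝ k x (EuclideanSpace.single i 1) := by
    conv_lhs => rw [← (EuclideanSpace.basisFun (Fin N) ℝ).sum_repr (W x)]
    simp [map_sum]
  unfold pdiv
  rw [fderiv_fun_smul hk hW, h1, Finset.mul_sum, ← Finset.sum_add_distrib]
  refine Finset.sum_congr rfl fun i _ => ?_
  simp
  ring

theorem continuous_pdiv {N : ℕ} {F : EuclideanSpace ℝ (Fin N) → EuclideanSpace ℝ (Fin N)}
    (hF : ContDiff ℝ 1 F) : Continuous (pdiv F) := by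
  have := hF.continuous_fderiv one_ne_zero
  unfold pdiv
  fun_prop

theorem hasCompactSupport_pdiv {N : ℕ} {F : EuclideanSpace ℝ (Fin N) → EuclideanSpace ℝ (Fin N)}
    (hF : HasCompactSupport F) : HasCompactSupport (pdiv F) := by
  refine (hF.fderiv ℝ).mono' fun x hx => subset_tsupport _ fun h0 => hx ?_
  simp [pdiv, h0]

theorem integral_pdiv_eq_zero {N : ℕ} {F : EuclideanSpace ℝ (Fin N) → EuclideanSpace ℝ (Fin N)}
    (hF : ContDiff ℝ 1 F) (hc : HasCompactSupport F) : ∫ x, pdiv F x = 0 := by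
  have hcont := hF.continuous_fderiv one_ne_zero
  have hd : ∀ i : Fin N, Continuous fun x => fderiv ℝ F x (EuclideanSpace.single i 1) i := by
    intro i
    fun_prop
  have hi : ∀ i : Fin N,
      Integrable fun x => fderiv ℝ F x (EuclideanSpace.single i 1) i := by
    intro i
    refine (hd i).integrable_of_hasCompactSupport ((hc.fderiv ℝ).mono' fun x hx =>
      subset_tsupport _ fun h0 => hx ?_)
    simp [h0]
  unfold pdiv
  rw [integral_finsetSum _ fun i _ => hi i]
  refine Finset.sum_eq_zero fun i _ => ?_
  have hcoord : ∀ x, fderiv ℝ (fun y => F y i) x (EuclideanSpace.single i 1)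
      = fderiv ℝ F x (EuclideanSpace.single i 1) i := by
    intro x
    have h := ((EuclideanSpace.proj (𝕜 := ℝ) i).hasFDerivAt.comp x
      (hF.differentiable one_ne_zero x).hasFDerivAt).fderiv
    exact congrArg (fun L => L (EuclideanSpace.single i 1)) h
  have hFi : Continuous fun x => F x i := by
    have := hF.continuous
    fun_prop
  have hFii : Integrable fun x => F x i := by
    refine hFi.integrable_of_hasCompactSupport (hc.mono fun x hx h0 => hx ?_)
    simp [h0]
  have key := integral_mul_fderiv_eq_neg_fderiv_mul_of_integrable (μ := volume)
    (f := fun x => F x i) (g := fun _ => (1 : ℝ)) (v := EuclideanSpace.single i 1)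
    (by simpa [hcoord] using hi i) (by simp) (by simpa using hFii)
    (fun x _ => by
      have := hF.differentiable one_ne_zero x
      fun_prop) (fun x _ => by fun_prop)
  simpa [hcoord] using key

theorem hasDerivAt_sq_max_zero (t : ℝ) :
    HasDerivAt (fun s : ℝ => max s 0 ^ 2) (2 * max t 0) t := by
  have hne : ∀ s : ℝ, s ≠ 0 → HasDerivAt (fun s : ℝ => max s 0 ^ 2) (2 * max s 0) s := by
    intro s hs
    rcases hs.lt_or_gt with h | h
    · rw [max_eq_right h.le, mul_zero]
      refine (hasDerivAt_const s (0 : ℝ)).congr_of_eventuallyEq ?_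
      filter_upwards [Iio_mem_nhds h] with y hy
      simp [max_eq_right (le_of_lt (mem_Iio.1 hy))]
    · rw [max_eq_left h.le]
      have h2 : HasDerivAt (fun y : ℝ => y ^ 2) (2 * s) s := by
        simpa using hasDerivAt_pow 2 s
      refine h2.congr_of_eventuallyEq ?_
      filter_upwards [Ioi_mem_nhds h] with y hy
      simp [max_eq_left (le_of_lt (mem_Ioi.1 hy))]
  refine hasDerivAt_of_hasDerivAt_of_ne' (x := 0) (g := fun s => 2 * max s 0) hne ?_ ?_ t
  · fun_prop
  · fun_prop

theorem contDiff_sq_max_zero : ContDiff ℝ 1 (fun s : ℝ => max s 0 ^ 2) := by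
  rw [contDiff_one_iff_deriv]
  refine ⟨fun t => (hasDerivAt_sq_max_zero t).differentiableAt, ?_⟩
  rw [funext fun t => (hasDerivAt_sq_max_zero t).deriv]
  fun_prop

/-- A weak maximum principle: a function which is nonpositive on the boundary of a bounded open
set is nonpositive inside if its derivative pairs strictly negatively (away from critical points)
with a vector field of nonpositive divergence. -/
theorem nonpos_of_pdiv_nonpos {N : ℕ} (hN : 1 ≤ N) {U : Set (EuclideanSpace ℝ (Fin N))}
    (hUo : IsOpen U) (hUb : Bornology.IsBounded U) {h : EuclideanSpace ℝ (Fin N) → ℝ}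
    {W : EuclideanSpace ℝ (Fin N) → EuclideanSpace ℝ (Fin N)}
    (hc : ContinuousOn h (closure U)) (h1 : ContDiffOn ℝ 1 h U) (hW : ContDiffOn ℝ 1 W U)
    (hbd : ∀ x ∈ frontier U, h x ≤ 0) (hdiv : ∀ x ∈ U, pdiv W x ≤ 0)
    (hle : ∀ x ∈ U, fderiv ℝ h x (W x) ≤ 0)
    (heq : ∀ x ∈ U, fderiv ℝ h x (W x) = 0 → fderiv ℝ h x = 0) :
    ∀ x ∈ U, h x ≤ 0 := by
  classical
  intro x₁ hx₁
  by_contra! hpos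
  obtain ⟨δ, hδ, hδx⟩ := exists_between hpos
  set K : Set (EuclideanSpace ℝ (Fin N)) := closure U ∩ h ⁻¹' Ici δ with hK
  have hKclosed : IsClosed K := hc.preimage_isClosed_of_isClosed isClosed_closure isClosed_Ici
  have hKc : IsCompact K := hUb.isCompact_closure.of_isClosed_subset hKclosed inter_subset_left
  have hKU : K ⊆ U := by
    rintro x ⟨hx, hxδ⟩
    by_contra hxU
    have := hbd x (by rw [hUo.frontier_eq]; exact ⟨hx, hxU⟩)
    have : δ ≤ h x := hxδ
    linarith
  set k : EuclideanSpace ℝ (Fin N) → ℝ :=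
    fun x => if x ∈ U then max (h x - δ) 0 ^ 2 else 0 with hk
  have hk0 : ∀ x, x ∉ K → k x = 0 := by
    intro x hx
    by_cases hxU : x ∈ U
    · have : h x < δ := by
        by_contra! hcon
        exact hx ⟨subset_closure hxU, hcon⟩
      simp [hk, hxU, this.le]
    · simp [hk, hxU]
  have hkU : ∀ x ∈ U, k =ᶠ[nhds x] fun y => max (h y - δ) 0 ^ 2 := by
    intro x hx
    filter_upwards [hUo.mem_nhds hx] with y hy
    simp [hk, hy]
  have hkK : ∀ x ∉ U, ∀ᶠ y in nhds x, k y = 0 := by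
    intro x hx
    filter_upwards [hKclosed.isOpen_compl.mem_nhds fun hxK => hx (hKU hxK)] with y hy
    exact hk0 y hy
  have hkC : ContDiff ℝ 1 k := by
    rw [contDiff_iff_contDiffAt]
    intro x
    by_cases hx : x ∈ U
    · refine ContDiffAt.congr_of_eventuallyEq ?_ (hkU x hx)
      exact contDiff_sq_max_zero.contDiffAt.comp x
        ((h1.contDiffAt (hUo.mem_nhds hx)).sub contDiffAt_const)
    · exact (contDiffAt_const (c := (0 : ℝ))).congr_of_eventuallyEq (hkK x hx)
  have hFC : ContDiff ℝ 1 fun x => k x • W x := by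
    rw [contDiff_iff_contDiffAt]
    intro x
    by_cases hx : x ∈ U
    · exact hkC.contDiffAt.smul (hW.contDiffAt (hUo.mem_nhds hx))
    · refine (contDiffAt_const (c := (0 : EuclideanSpace ℝ (Fin N)))).congr_of_eventuallyEq ?_
      filter_upwards [hkK x hx] with y hy
      simp [hy]
  have hkc : HasCompactSupport k := HasCompactSupport.intro hKc hk0
  have hFc : HasCompactSupport fun x => k x • W x :=
    HasCompactSupport.intro hKc fun x hx => by simp [hk0 x hx]
  have hkd : ∀ x ∈ U, fderiv ℝ k x = (2 * max (h x - δ) 0) • fderiv ℝ h x := by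
    intro x hx
    rw [(hkU x hx).fderiv_eq]
    have hh := ((h1.contDiffAt (hUo.mem_nhds hx)).differentiableAt one_ne_zero).hasFDerivAt
    exact ((hasDerivAt_sq_max_zero (h x - δ)).comp_hasFDerivAt x (hh.sub_const δ)).fderiv
  have hkd0 : ∀ x ∉ U, fderiv ℝ k x = 0 := by
    intro x hx
    rw [Filter.EventuallyEq.fderiv_eq (hkK x hx)]
    simp
  have hknn : ∀ x, 0 ≤ k x := by
    intro x
    by_cases hx : x ∈ U
    · simp only [hk, hx, if_true]
      positivity
    · simp [hk, hx]
  have hpd : ∀ x ∈ U, pdiv (fun x => k x • W x) x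
      = 2 * max (h x - δ) 0 * fderiv ℝ h x (W x) + k x * pdiv W x := by
    intro x hx
    rw [pdiv_smul (hkC.differentiable one_ne_zero x)
      ((hW.contDiffAt (hUo.mem_nhds hx)).differentiableAt one_ne_zero), hkd x hx]
    simp
  have hterm : ∀ x ∈ U, 2 * max (h x - δ) 0 * fderiv ℝ h x (W x) ≤ 0 := fun x hx =>
    mul_nonpos_of_nonneg_of_nonpos (by positivity) (hle x hx)
  have hterm' : ∀ x ∈ U, k x * pdiv W x ≤ 0 := fun x hx =>
    mul_nonpos_of_nonneg_of_nonpos (hknn x) (hdiv x hx)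
  have hpn : ∀ x, pdiv (fun x => k x • W x) x ≤ 0 := by
    intro x
    by_cases hx : x ∈ U
    · rw [hpd x hx]
      linarith [hterm x hx, hterm' x hx]
    · have : (fun x => k x • W x) =ᶠ[nhds x] fun _ => 0 := by
        filter_upwards [hkK x hx] with y hy
        simp [hy]
      simp [pdiv, this.fderiv_eq]
  have hp0 : ∀ x, pdiv (fun x => k x • W x) x = 0 := by
    intro x
    by_contra hne
    have := Continuous.integral_pos_of_hasCompactSupport_nonneg_nonzero (μ := volume)
      (f := fun x => -pdiv (fun x => k x • W x) x) (x := x) (continuous_pdiv hFC).neg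
      (hasCompactSupport_pdiv hFc).neg (fun y => by simpa using hpn y) (by simpa using hne)
    rw [integral_neg, integral_pdiv_eq_zero hFC hFc] at this
    simp at this
  have hdk : ∀ x, fderiv ℝ k x = 0 := by
    intro x
    by_cases hx : x ∈ U
    · rw [hkd x hx]
      have h0 := hp0 x
      rw [hpd x hx] at h0
      have h2 : 2 * max (h x - δ) 0 * fderiv ℝ h x (W x) = 0 := by
        linarith [hterm x hx, hterm' x hx]
      rcases mul_eq_zero.1 h2 with h3 | h3
      · rw [h3, zero_smul]
      · rw [heq x hx h3, smul_zero]
    · exact hkd0 x hx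
  have : Nonempty (Fin N) := ⟨⟨0, hN⟩⟩
  have : NoncompactSpace (EuclideanSpace ℝ (Fin N)) :=
    NormedSpace.noncompactSpace ℝ (EuclideanSpace ℝ (Fin N))
  obtain ⟨y, hy⟩ := (ne_univ_iff_exists_notMem K).1 hKc.ne_univ
  have hxy := is_const_of_fderiv_eq_zero (𝕜 := ℝ) (hkC.differentiable one_ne_zero) hdk x₁ y
  rw [hk0 y hy] at hxy
  have hgt : 0 < max (h x₁ - δ) 0 := lt_max_of_lt_left (by linarith)
  have : 0 < k x₁ := by
    simp only [hk, hx₁, if_true]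
    positivity
  linarith

theorem inner_rpow_norm_smul_sub {E : Type*} [NormedAddCommGroup E] [InnerProductSpace ℝ E]
    {p : ℝ} (hp : 1 < p) (a b : E) :
    0 ≤ inner ℝ (‖a‖ ^ (p - 2) • a - ‖b‖ ^ (p - 2) • b) (a - b) ∧
    (inner ℝ (‖a‖ ^ (p - 2) • a - ‖b‖ ^ (p - 2) • b) (a - b) = 0 → a = b) := by
  have hpow : ∀ c : E, ‖c‖ ^ (p - 2) * ‖c‖ = ‖c‖ ^ (p - 1) := by
    intro c
    rw [← Real.rpow_add_one' (norm_nonneg c) (by linarith)]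
    congr 1
    ring
  have hexp : inner ℝ (‖a‖ ^ (p - 2) • a - ‖b‖ ^ (p - 2) • b) (a - b)
      = (‖a‖ ^ (p - 1) - ‖b‖ ^ (p - 1)) * (‖a‖ - ‖b‖)
        + (‖a‖ ^ (p - 2) + ‖b‖ ^ (p - 2)) * (‖a‖ * ‖b‖ - inner ℝ a b) := by
    rw [← hpow a, ← hpow b]
    simp only [inner_sub_left, inner_sub_right, real_inner_smul_left, real_inner_self_eq_norm_sq,
      real_inner_comm a b]
    ring
  have hcs : 0 ≤ ‖a‖ * ‖b‖ - inner ℝ a b := sub_nonneg.2 (real_inner_le_norm a b)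
  have h2 : 0 ≤ (‖a‖ ^ (p - 2) + ‖b‖ ^ (p - 2)) * (‖a‖ * ‖b‖ - inner ℝ a b) := by positivity
  have hlt : ∀ s t : ℝ, 0 ≤ s → s < t → 0 < (s ^ (p - 1) - t ^ (p - 1)) * (s - t) := by
    intro s t hs hst
    have := Real.rpow_lt_rpow hs hst (by linarith : 0 < p - 1)
    exact mul_pos_of_neg_of_neg (by linarith) (by linarith)
  have h1 : 0 ≤ (‖a‖ ^ (p - 1) - ‖b‖ ^ (p - 1)) * (‖a‖ - ‖b‖) := by
    rcases lt_trichotomy ‖a‖ ‖b‖ with h | h | h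
    · exact (hlt _ _ (norm_nonneg a) h).le
    · simp [h]
    · linarith [hlt _ _ (norm_nonneg b) h]
  rw [hexp]
  refine ⟨by positivity, fun h0 => ?_⟩
  have h1' : (‖a‖ ^ (p - 1) - ‖b‖ ^ (p - 1)) * (‖a‖ - ‖b‖) = 0 := by linarith
  have h2' : (‖a‖ ^ (p - 2) + ‖b‖ ^ (p - 2)) * (‖a‖ * ‖b‖ - inner ℝ a b) = 0 := by linarith
  have hab : ‖a‖ = ‖b‖ := by
    rcases lt_trichotomy ‖a‖ ‖b‖ with h | h | h
    · exact absurd h1' (hlt _ _ (norm_nonneg a) h).ne'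
    · exact h
    · linarith [hlt _ _ (norm_nonneg b) h]
  rcases (norm_nonneg b).eq_or_lt with hb | hb
  · rw [norm_eq_zero.1 hb.symm, norm_eq_zero.1 (hab.trans hb.symm)]
  · have hpos : 0 < ‖b‖ ^ (p - 2) := Real.rpow_pos_of_pos hb _
    rw [hab] at h2'
    have hin : ‖b‖ * ‖b‖ - inner ℝ a b = 0 :=
      (mul_eq_zero.1 h2').resolve_left (by linarith)
    have hsq : ‖a - b‖ ^ 2 = 0 := by
      rw [norm_sub_sq_real, hab]
      linarith
    exact sub_eq_zero.1 (norm_eq_zero.1 (pow_eq_zero_iff two_ne_zero |>.1 hsq))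

theorem fderiv_eq_inner_gradient {N : ℕ} (u : EuclideanSpace ℝ (Fin N) → ℝ)
    (x v : EuclideanSpace ℝ (Fin N)) : fderiv ℝ u x v = inner ℝ (gradient u x) v := by
  rw [← toDual_gradient, InnerProductSpace.toDual_apply_apply]

/-- Comparison principle for the `p`-Laplacian. -/
theorem le_of_pdiv_flux_le {N : ℕ} (hN : 1 ≤ N) {p : ℝ} (hp : 1 < p)
    {U : Set (EuclideanSpace ℝ (Fin N))} (hUo : IsOpen U) (hUb : Bornology.IsBounded U)
    {u v : EuclideanSpace ℝ (Fin N) → ℝ}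
    (huc : ContinuousOn u (closure U)) (hvc : ContinuousOn v (closure U))
    (hu : ContDiffOn ℝ 1 u U) (hv : ContDiffOn ℝ 1 v U)
    (hfu : ContDiffOn ℝ 1 (flux p u) U) (hfv : ContDiffOn ℝ 1 (flux p v) U)
    (hbd : ∀ x ∈ frontier U, u x ≤ v x)
    (hdiv : ∀ x ∈ U, pdiv (flux p v) x ≤ pdiv (flux p u) x) :
    ∀ x ∈ U, u x ≤ v x := by
  have hda : ∀ {F : Type} [NormedAddCommGroup F] [NormedSpace ℝ F]
      {f : EuclideanSpace ℝ (Fin N) → F}, ContDiffOn ℝ 1 f U → ∀ x ∈ U,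
      DifferentiableAt ℝ f x := fun hf x hx =>
    (hf.contDiffAt (hUo.mem_nhds hx)).differentiableAt one_ne_zero
  have hfd : ∀ x ∈ U, fderiv ℝ (fun y => u y - v y) x (flux p v x - flux p u x)
      = -inner ℝ (flux p u x - flux p v x) (gradient u x - gradient v x) := by
    intro x hx
    rw [fderiv_fun_sub (hda hu x hx) (hda hv x hx), sub_apply,
      fderiv_eq_inner_gradient, fderiv_eq_inner_gradient, ← inner_sub_left, real_inner_comm,
      ← inner_neg_left, neg_sub]
  have key := nonpos_of_pdiv_nonpos hN hUo hUb (h := fun y => u y - v y)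
    (W := fun y => flux p v y - flux p u y) (huc.sub hvc) (hu.sub hv) (hfv.sub hfu)
    (fun x hx => sub_nonpos.2 (hbd x hx)) (fun x hx => ?_) (fun x hx => ?_) (fun x hx h0 => ?_)
  · exact fun x hx => sub_nonpos.1 (key x hx)
  · have := hdiv x hx
    unfold pdiv at this ⊢
    rw [fderiv_fun_sub (hda hfv x hx) (hda hfu x hx)]
    simpa using this
  · rw [hfd x hx, neg_nonpos]
    exact (inner_rpow_norm_smul_sub hp _ _).1
  · rw [hfd x hx, neg_eq_zero] at h0
    have := (inner_rpow_norm_smul_sub hp _ _).2 h0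
    ext y
    rw [fderiv_fun_sub (hda hu x hx) (hda hv x hx), sub_apply,
      fderiv_eq_inner_gradient, fderiv_eq_inner_gradient, this]
    simp

theorem flux_const {N : ℕ} (p c : ℝ) :
    flux p (fun _ : EuclideanSpace ℝ (Fin N) => c) = fun _ => 0 := by
  ext x : 1
  simp [flux, gradient]

/-- The flux of the `p`-torsion function of a ball. -/
theorem flux_ball_torsion {N : ℕ} (hN : 1 ≤ N) {p : ℝ} (hp : 1 < p)
    (x₀ : EuclideanSpace ℝ (Fin N)) (d : ℝ) :
    flux p (fun x => ((p - 1) / p) * (N : ℝ) ^ (-(1 / (p - 1))) *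
      (d - ‖x - x₀‖ ^ (p / (p - 1)))) = fun x => -(N : ℝ)⁻¹ • (x - x₀) := by
  have hp1 : 0 < p - 1 := by linarith
  have hq : 1 < p / (p - 1) := by
    rw [lt_div_iff₀ hp1]
    linarith
  have hN0 : (0 : ℝ) < N := by exact_mod_cast hN
  ext x : 1
  set y := x - x₀ with hy
  set a : ℝ := (N : ℝ) ^ (-(1 / (p - 1))) with ha
  have ha0 : 0 < a := Real.rpow_pos_of_pos hN0 _
  have hg : gradient (fun x => ((p - 1) / p) * a * (d - ‖x - x₀‖ ^ (p / (p - 1)))) x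
      = -(a * ‖y‖ ^ (p / (p - 1) - 2)) • y := by
    refine HasGradientAt.gradient ?_
    rw [hasGradientAt_iff_hasFDerivAt]
    have h1 := (hasFDerivAt_norm_rpow y hq).comp x ((hasFDerivAt_id x).sub_const x₀)
    have h2 := (h1.const_sub d).const_mul ((p - 1) / p * a)
    refine h2.congr_fderiv ?_
    ext v
    simp
    field_simp
  unfold flux
  rw [hg]
  rcases eq_or_ne y 0 with h0 | h0
  · simp [h0]
  have hn : 0 < ‖y‖ := norm_pos_iff.2 h0
  have hA : 0 < a * ‖y‖ ^ (p / (p - 1) - 2) := by positivity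
  rw [norm_smul, norm_neg, Real.norm_of_nonneg hA.le, smul_smul]
  congr 1
  rw [mul_neg, neg_inj]
  rw [mul_assoc, ← Real.rpow_add_one hn.ne', Real.mul_rpow ha0.le (by positivity),
    ← Real.rpow_mul hn.le]
  calc a ^ (p - 2) * ‖y‖ ^ ((p / (p - 1) - 2 + 1) * (p - 2)) * (a * ‖y‖ ^ (p / (p - 1) - 2))
      = (a ^ (p - 2) * a) *
        (‖y‖ ^ ((p / (p - 1) - 2 + 1) * (p - 2)) * ‖y‖ ^ (p / (p - 1) - 2)) := by ring
    _ = (N : ℝ)⁻¹ := by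
      rw [← Real.rpow_add_one ha0.ne', ← Real.rpow_add hn, ha, ← Real.rpow_mul hN0.le]
      have h1 : -(1 / (p - 1)) * (p - 2 + 1) = -1 := by
        field_simp
        ring
      have h2 : (p / (p - 1) - 2 + 1) * (p - 2) + (p / (p - 1) - 2) = 0 := by
        field_simp
        ring
      rw [h1, h2, Real.rpow_zero, mul_one, Real.rpow_neg_one]

theorem pdiv_smul_sub_const {N : ℕ} (c : ℝ) (x₀ x : EuclideanSpace ℝ (Fin N)) :
    pdiv (fun x => c • (x - x₀)) x = N * c := by
  have h : HasFDerivAt (fun x : EuclideanSpace ℝ (Fin N) => c • (x - x₀))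
      (c • ContinuousLinearMap.id ℝ (EuclideanSpace ℝ (Fin N))) x :=
    ((hasFDerivAt_id x).sub_const x₀).const_smul c
  simp [pdiv, h.fderiv]

/-- lower bound for the `p`-torsion function `ψ` of a bounded open set
`Ω` (i.e. `-Δ_p ψ = 1` in `Ω`, `ψ = 0` on `∂Ω`): if `B_r(x₀) ⊆ Ω` then
`ψ(x₀) ≥ ((p-1)/p) N^(-1/(p-1)) r^(p/(p-1))`, and in particular the same lower bound
holds for `sup_Ω ψ`. -/
theorem stmt12 {N : ℕ} (hN : 1 ≤ N) (p : ℝ) (hp : 1 < p)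
    (Ω : Set (EuclideanSpace ℝ (Fin N))) (hΩo : IsOpen Ω) (hΩb : Bornology.IsBounded Ω)
    (ψ : EuclideanSpace ℝ (Fin N) → ℝ)
    (hψc : ContinuousOn ψ (closure Ω)) (hψ1 : ContDiffOn ℝ 1 ψ Ω)
    (hψbd : ∀ x ∈ frontier Ω, ψ x = 0)
    (hψflux : ContDiffOn ℝ 1 (flux p ψ) Ω)
    (hψeq : ∀ x ∈ Ω, pdiv (flux p ψ) x = -1)
    (x₀ : EuclideanSpace ℝ (Fin N)) (r : ℝ) (hr : 0 < r)
    (hball : ball x₀ r ⊆ Ω) :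
    ((p - 1) / p) * (N : ℝ) ^ (-(1 / (p - 1))) * r ^ (p / (p - 1)) ≤ ψ x₀ ∧
    ((p - 1) / p) * (N : ℝ) ^ (-(1 / (p - 1))) * r ^ (p / (p - 1)) ≤ sSup (ψ '' Ω) := by
  have hp1 : 0 < p - 1 := by linarith
  have hq : 1 < p / (p - 1) := by
    rw [lt_div_iff₀ hp1]
    linarith
  have hN0 : (0 : ℝ) < N := by exact_mod_cast hN
  have hnn : ∀ x ∈ Ω, 0 ≤ ψ x := by
    refine le_of_pdiv_flux_le hN hp hΩo hΩb (u := fun _ => 0) continuousOn_const hψc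
      contDiffOn_const hψ1 ?_ hψflux (fun x hx => (hψbd x hx).ge) fun x hx => ?_
    · rw [flux_const]
      exact contDiffOn_const
    · rw [hψeq x hx, flux_const]
      simp [pdiv]
  have hnn' : ∀ x ∈ closure Ω, 0 ≤ ψ x := by
    intro x hx
    by_cases hxΩ : x ∈ Ω
    · exact hnn x hxΩ
    · exact (hψbd x (by rw [hΩo.frontier_eq]; exact ⟨hx, hxΩ⟩)).ge
  set w : EuclideanSpace ℝ (Fin N) → ℝ := fun x => ((p - 1) / p) *
    (N : ℝ) ^ (-(1 / (p - 1))) * (r ^ (p / (p - 1)) - ‖x - x₀‖ ^ (p / (p - 1))) with hw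
  have hwC : ContDiff ℝ 1 w :=
    contDiff_const.mul (contDiff_const.sub
      ((contDiff_norm_rpow (E := EuclideanSpace ℝ (Fin N)) hq).comp
        (contDiff_id.sub contDiff_const)))
  have hfw : flux p w = fun x => -(N : ℝ)⁻¹ • (x - x₀) := flux_ball_torsion hN hp x₀ _
  have hcmp : ∀ x ∈ ball x₀ r, w x ≤ ψ x := by
    refine le_of_pdiv_flux_le hN hp isOpen_ball isBounded_ball hwC.continuous.continuousOn
      (hψc.mono (closure_mono hball)) hwC.contDiffOn (hψ1.mono hball) ?_ (hψflux.mono hball)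
      (fun x hx => ?_) fun x hx => ?_
    · rw [hfw]
      fun_prop
    · have hxr : ‖x - x₀‖ = r := by
        rw [frontier_ball x₀ hr.ne'] at hx
        exact mem_sphere_iff_norm.1 hx
      have hw0 : w x = 0 := by simp [hw, hxr]
      rw [hw0]
      exact hnn' x (closure_mono hball (frontier_subset_closure hx))
    · rw [hψeq x (hball hx), hfw, pdiv_smul_sub_const]
      exact (by field_simp : -1 = (N : ℝ) * -(N : ℝ)⁻¹).le
  have hx₀ : x₀ ∈ ball x₀ r := mem_ball_self hr
  have hfirst : ((p - 1) / p) * (N : ℝ) ^ (-(1 / (p - 1))) * r ^ (p / (p - 1)) ≤ ψ x₀ := by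
    have h := hcmp x₀ hx₀
    simpa [hw, Real.zero_rpow (by linarith : p / (p - 1) ≠ 0)] using h
  have hbdd : BddAbove (ψ '' Ω) :=
    (hΩb.isCompact_closure.bddAbove_image hψc).mono (image_mono subset_closure)
  exact ⟨hfirst, hfirst.trans (le_csSup hbdd (mem_image_of_mem ψ (hball hx₀)))⟩
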